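/- Every planar graph is (4,1)-choosable. -/

import Mathlib

open SimpleGraph

/-- A proper coloring of `G` from the list assignment `L`. -/
def ProperListColoring {V : Type*} (G : SimpleGraph V) (L : V → Finset ℕ) (φ : V → ℕ) : Prop :=
  (∀ v, φ v ∈ L v) ∧ ∀ ⦃u v⦄, G.Adj u v → φ u ≠ φ v

/-- `G` is `(k,d)`-choosable. -/
def Choosable {V : Type*} (G : SimpleGraph V) (k d : ℕ) : Prop :=
  ∀ L : V → Finset ℕ, (∀ v, k ≤ (L v).card) →
    (∀ u v, G.Adj u v → (L u ∩ L v).card ≤ d) →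
    ∃ φ, ProperListColoring G L φ

/-- `H` is a minor of `G`. -/
def HasMinor {V W : Type*} (G : SimpleGraph V) (H : SimpleGraph W) : Prop :=
  ∃ B : W → Set V, (∀ w, (B w).Nonempty) ∧
    (Pairwise fun w₁ w₂ => Disjoint (B w₁) (B w₂)) ∧
    (∀ w, (G.induce (B w)).Connected) ∧
    ∀ ⦃w₁ w₂⦄, H.Adj w₁ w₂ → ∃ v₁ ∈ B w₁, ∃ v₂ ∈ B w₂, G.Adj v₁ v₂

/-- Planarity via Wagner's theorem: no `K₅` minor and no `K₃,₃` minor. -/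
def IsPlanar {V : Type*} (G : SimpleGraph V) : Prop :=
  ¬ HasMinor G (⊤ : SimpleGraph (Fin 5)) ∧
  ¬ HasMinor G (completeBipartiteGraph (Fin 3) (Fin 3))

/-- The minor relation is transitive. -/
theorem HasMinor.trans {U V W : Type*} {G : SimpleGraph U} {H : SimpleGraph V}
    {K : SimpleGraph W} (h₁ : HasMinor G H) (h₂ : HasMinor H K) : HasMinor G K := by
  obtain ⟨A, hAn, hAd, hAc, hAa⟩ := h₁
  obtain ⟨B, hBn, hBd, hBc, hBa⟩ := h₂
  refine ⟨fun w => ⋃ x ∈ B w, A x, fun w => ?_, fun w₁ w₂ hw => ?_, fun w => ?_,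
    fun w₁ w₂ hw => ?_⟩
  · obtain ⟨x, hx⟩ := hBn w
    obtain ⟨a, ha⟩ := hAn x
    exact ⟨a, Set.mem_biUnion hx ha⟩
  · refine Set.disjoint_left.2 fun a h₁ h₂ => ?_
    simp only [Set.mem_iUnion, exists_prop] at h₁ h₂
    obtain ⟨x, hx, hax⟩ := h₁
    obtain ⟨y, hy, hay⟩ := h₂
    have hxy : x ≠ y := fun h => Set.disjoint_left.1 (hBd hw) hx (h ▸ hy)
    exact Set.disjoint_left.1 (hAd hxy) hax hay
  · have hsub : ∀ x ∈ B w, A x ⊆ ⋃ x ∈ B w, A x := fun x hx => Set.subset_biUnion_of_mem hx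
    have hbag : ∀ x (hx : x ∈ B w) a b (ha : a ∈ A x) (hb : b ∈ A x),
        (G.induce (⋃ x ∈ B w, A x)).Reachable ⟨a, hsub x hx ha⟩ ⟨b, hsub x hx hb⟩ := by
      intro x hx a b ha hb
      exact ((hAc x).preconnected ⟨a, ha⟩ ⟨b, hb⟩).map
        (SimpleGraph.induceHomOfLE G (hsub x hx)).toHom
    have hwalk : ∀ x y : B w, (H.induce (B w)).Reachable x y →
        ∀ a b (ha : a ∈ A x) (hb : b ∈ A y),
        (G.induce (⋃ x ∈ B w, A x)).Reachable ⟨a, hsub x x.2 ha⟩ ⟨b, hsub y y.2 hb⟩ := by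
      rintro x y ⟨p⟩
      induction p with
      | nil => exact fun a b ha hb => hbag _ (Subtype.prop _) a b ha hb
      | @cons x z y hxz p ih =>
        intro a b ha hb
        obtain ⟨c, hc, d, hd, hcd⟩ := hAa hxz
        refine (hbag x x.2 a c ha hc).trans (Reachable.trans ?_ (ih d b hd hb))
        exact Adj.reachable (by simpa using hcd)
    obtain ⟨x, hx⟩ := hBn w
    obtain ⟨a, ha⟩ := hAn x
    have : Nonempty (⋃ x ∈ B w, A x : Set U) := ⟨⟨a, hsub x hx ha⟩⟩
    refine ⟨?_⟩
    rintro ⟨a, ha⟩ ⟨b, hb⟩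
    have ha' := ha
    have hb' := hb
    simp only [Set.mem_iUnion, exists_prop] at ha' hb'
    obtain ⟨x, hx, hax⟩ := ha'
    obtain ⟨y, hy, hby⟩ := hb'
    exact hwalk ⟨x, hx⟩ ⟨y, hy⟩ ((hBc w).preconnected _ _) a b hax hby
  · obtain ⟨x, hx, y, hy, hxy⟩ := hBa hw
    obtain ⟨a, ha, b, hb, hab⟩ := hAa hxy
    exact ⟨a, Set.mem_biUnion hx ha, b, Set.mem_biUnion hy hb, hab⟩

theorem SimpleGraph.induce_singleton_connected {V : Type*} (G : SimpleGraph V) (v : V) :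
    (G.induce {v}).Connected :=
  (SimpleGraph.connected_iff _).2 ⟨Preconnected.of_subsingleton, ⟨⟨v, rfl⟩⟩⟩

/-- An injective homomorphism into `G` exhibits its source as a minor of `G`. -/
theorem HasMinor.of_injective_hom {V W : Type*} {G : SimpleGraph V} {H : SimpleGraph W}
    (f : H →g G) (hf : Function.Injective f) : HasMinor G H :=
  ⟨fun w => {f w}, fun _ => Set.singleton_nonempty _,
    fun _ _ h => Set.disjoint_singleton.2 (hf.ne h),
    fun _ => G.induce_singleton_connected _, fun _ _ h => ⟨_, rfl, _, rfl, f.map_adj h⟩⟩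

theorem hasMinor_induce {V : Type*} (G : SimpleGraph V) (s : Set V) :
    HasMinor G (G.induce s) :=
  .of_injective_hom (Embedding.induce s).toHom (Embedding.induce (G := G) s).injective

/-- The graph obtained from `G` by contracting `v` into `u`. -/
def SimpleGraph.contractInto {V : Type*} (G : SimpleGraph V) (u v : V) :
    SimpleGraph ({v}ᶜ : Set V) :=
  G.induce {v}ᶜ ⊔ .fromRel fun x y => (x : V) = u ∧ G.Adj v y

theorem hasMinor_contractInto {V : Type*} (G : SimpleGraph V) {u v : V} (huv : G.Adj u v) :
    HasMinor G (G.contractInto u v) := by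
  refine ⟨fun x => {y | y = x ∨ (x : V) = u ∧ y = v}, fun x => ⟨x, .inl rfl⟩,
    fun x y hxy => ?_, fun x => ?_, fun x y hxy => ?_⟩
  · have h : (x : V) ≠ y := Subtype.coe_injective.ne hxy
    have hx : (x : V) ≠ v := x.2
    have hy : (y : V) ≠ v := y.2
    refine Set.disjoint_left.2 fun a => ?_
    simp only [Set.mem_ofPred_eq]
    grind
  · change (G.induce {y | y = (x : V) ∨ (x : V) = u ∧ y = v}).Connected
    by_cases h : (x : V) = u
    · have : {y | y = (x : V) ∨ (x : V) = u ∧ y = v} = {u, v} := by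
        ext y; simp [h]
      rw [this]
      exact induce_pair_connected_of_adj huv
    · have : {y | y = (x : V) ∨ (x : V) = u ∧ y = v} = {(x : V)} := by
        ext y; simp [h]
      rw [this]
      exact G.induce_singleton_connected _
  · simp only [contractInto, sup_adj, fromRel_adj, comap_adj, Function.Embedding.subtype_apply]
      at hxy
    rcases hxy with h | ⟨-, ⟨h, h'⟩ | ⟨h, h'⟩⟩
    · exact ⟨x, .inl rfl, y, .inl rfl, h⟩
    · exact ⟨v, .inr ⟨h, rfl⟩, y, .inl rfl, h'⟩
    · exact ⟨x, .inl rfl, v, .inr ⟨h, rfl⟩, h'.symm⟩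

theorem SimpleGraph.card_edgeFinset_eq_ncard {V : Type*} (G : SimpleGraph V)
    [Fintype G.edgeSet] : G.edgeFinset.card = G.edgeSet.ncard :=
  (Set.ncard_eq_toFinset_card' _).symm

open Classical in
theorem SimpleGraph.ncard_edgeSet_le_induce_compl_singleton {V : Type*} [Fintype V]
    (G : SimpleGraph V) (v : V) :
    G.edgeSet.ncard ≤ (G.induce {v}ᶜ).edgeSet.ncard + G.degree v := by
  have h₁ := G.card_edgeFinset_induce_compl_singleton v
  have h₂ := G.card_edgeFinset_deleteIncidenceSet v
  rw [card_edgeFinset_eq_ncard, card_edgeFinset_eq_ncard] at h₁ h₂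
  omega

open Classical in
/-- Contracting an edge destroys that edge and one edge for each common neighbour of its ends. -/
theorem SimpleGraph.ncard_edgeSet_le_contractInto {V : Type*} [Fintype V] (G : SimpleGraph V)
    {u v : V} (huv : G.Adj u v) :
    G.edgeSet.ncard ≤ (G.contractInto u v).edgeSet.ncard + 1 +
      (G.neighborFinset u ∩ G.neighborFinset v).card := by
  have hdel := G.ncard_edgeSet_le_induce_compl_singleton v
  let u' : ({v}ᶜ : Set V) := ⟨u, huv.ne⟩
  let N : Finset ({v}ᶜ : Set V) :=
    Finset.univ.filter fun x => G.Adj v x ∧ (x : V) ≠ u ∧ ¬ G.Adj u x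
  have hN : G.degree v ≤ N.card + 1 + (G.neighborFinset u ∩ G.neighborFinset v).card := by
    have hsub : G.neighborFinset v ⊆ N.map (.subtype _) ∪ {u} ∪
        (G.neighborFinset u ∩ G.neighborFinset v) := by
      intro x hx
      rw [mem_neighborFinset] at hx
      have hxv : x ≠ v := hx.ne'
      simp only [N, Finset.mem_union, Finset.mem_map, Finset.mem_filter, Finset.mem_univ,
        true_and, Finset.mem_singleton, Finset.mem_inter, mem_neighborFinset]
      by_cases h₁ : x = u
      · exact .inl (.inr h₁)
      by_cases h₂ : G.Adj u x
      · exact .inr ⟨h₂, hx⟩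
      · exact .inl (.inl ⟨⟨x, hxv⟩, ⟨hx, h₁, h₂⟩, rfl⟩)
    calc G.degree v = (G.neighborFinset v).card := rfl
      _ ≤ _ := Finset.card_le_card hsub
      _ ≤ _ := Finset.card_union_le _ _
      _ ≤ _ := by
        gcongr
        refine (Finset.card_union_le _ _).trans ?_
        simp
  have hnew : (G.induce {v}ᶜ).edgeSet.ncard + N.card ≤ (G.contractInto u v).edgeSet.ncard := by
    rw [← card_edgeFinset_eq_ncard, ← card_edgeFinset_eq_ncard]
    have hinj : Set.InjOn (fun x => s(u', x)) (N : Set ({v}ᶜ : Set V)) := by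
      intro x _ y _ h
      exact Sym2.congr_right.1 h
    rw [← Finset.card_image_of_injOn hinj, ← Finset.card_union_of_disjoint]
    · refine Finset.card_le_card fun e he => ?_
      rw [Finset.mem_union, Finset.mem_image] at he
      rw [mem_edgeFinset]
      rcases he with he | ⟨x, hx, rfl⟩
      · exact edgeSet_mono le_sup_left (mem_edgeFinset.1 he)
      · simp only [N, Finset.mem_filter, Finset.mem_univ, true_and] at hx
        have hne : u' ≠ x := fun h => hx.2.1 (congrArg Subtype.val h).symm
        exact .inr ⟨hne, .inl ⟨rfl, hx.1⟩⟩
    · refine Finset.disjoint_left.2 fun e he he' => ?_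
      obtain ⟨x, hx, rfl⟩ := Finset.mem_image.1 he'
      simp only [N, Finset.mem_filter, Finset.mem_univ, true_and] at hx
      exact hx.2.2 (by simpa [u'] using he)
  omega

/-- A vertex with five neighbours spanning a wheel gives a `K₅` minor. -/
theorem hasMinor_top_five_of_wheel {V : Type*} {G : SimpleGraph V} {v a b c d e : V}
    (hva : G.Adj v a) (hvb : G.Adj v b) (hvc : G.Adj v c) (hvd : G.Adj v d) (hve : G.Adj v e)
    (hac : G.Adj a c) (hbc : G.Adj b c) (had : G.Adj a d) (hae : G.Adj a e) (hbd : G.Adj b d)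
    (hbe : G.Adj b e) (hde : G.Adj d e) (hab : a ≠ b) (hcd : c ≠ d) (hce : c ≠ e) :
    HasMinor G (⊤ : SimpleGraph (Fin 5)) := by
  refine ⟨![{v}, {a, c}, {b}, {d}, {e}], fun i => ?_, fun i j hij => ?_, fun i => ?_,
    fun i j hij => ?_⟩
  · fin_cases i <;> simp
  · have := hva.ne; have := hvb.ne; have := hvc.ne; have := hvd.ne; have := hve.ne
    have := hbc.ne; have := had.ne; have := hae.ne; have := hbd.ne
    have := hbe.ne; have := hde.ne
    fin_cases i <;> fin_cases j <;> simp at hij ⊢ <;> grind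
  · have := G.induce_singleton_connected
    have := induce_pair_connected_of_adj hac
    fin_cases i <;> simp_all
  · have := hva.symm; have := hvb.symm; have := hvd.symm; have := hve.symm
    have := hbc.symm; have := had.symm; have := hae.symm; have := hbd.symm
    have := hbe.symm; have := hde.symm
    fin_cases i <;> fin_cases j <;> simp at hij ⊢ <;> simp [*]

open Classical in
/-- A vertex of degree at most five all of whose edges lie in three triangles gives a `K₅` minor. -/
theorem hasMinor_top_five_of_degree_le {V : Type*} [Fintype V] {G : SimpleGraph V} {v : V}
    (h₄ : 4 ≤ G.degree v) (h₅ : G.degree v ≤ 5)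
    (h : ∀ x, G.Adj v x → 3 ≤ (G.neighborFinset v ∩ G.neighborFinset x).card) :
    HasMinor G (⊤ : SimpleGraph (Fin 5)) := by
  have hmiss : ∀ x, G.Adj v x → ((G.neighborFinset v).filter fun y => ¬ G.Adj x y).card + 3 ≤
      G.degree v := by
    intro x hx
    have h₁ := h x hx
    have h₂ := Finset.card_filter_add_card_filter_not (s := G.neighborFinset v) (G.Adj x ·)
    have h₃ : G.neighborFinset v ∩ G.neighborFinset x = (G.neighborFinset v).filter (G.Adj x ·) := by
      ext y; simp
    rw [h₃] at h₁
    rw [card_neighborFinset_eq_degree] at h₂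
    omega
  by_cases hclique : ∀ x, G.Adj v x → ∀ y, G.Adj v y → x ≠ y → G.Adj x y
  · obtain ⟨s, hs, hcard⟩ := Finset.exists_subset_card_eq h₄
    have hsv : ∀ x ∈ s, G.Adj v x := fun x hx => by simpa using hs hx
    have hv : v ∉ s := fun hv => (hsv v hv).ne rfl
    have hK : (insert v s).card = 5 := by rw [Finset.card_insert_of_notMem hv, hcard]
    let f := (insert v s).equivFinOfCardEq hK
    refine .of_injective_hom ⟨fun i => (f.symm i : V), ?_⟩
      (Subtype.coe_injective.comp f.symm.injective)
    intro i j hij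
    have hne : (f.symm i : V) ≠ f.symm j :=
      Subtype.coe_injective.ne (f.symm.injective.ne hij)
    have hi := (f.symm i).2
    have hj := (f.symm j).2
    rw [Finset.mem_insert] at hi hj
    rcases hi with hi | hi <;> rcases hj with hj | hj
    · exact absurd (hi.trans hj.symm) hne
    · rw [hi]; exact hsv _ hj
    · rw [hj]; exact (hsv _ hi).symm
    · exact hclique _ (hsv _ hi) _ (hsv _ hj) hne
  · push Not at hclique
    obtain ⟨a, hva, b, hvb, hab, hnab⟩ := hclique
    have hone : ∀ x, G.Adj v x → ∀ y, G.Adj v y → x ≠ y → ¬ G.Adj x y →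
        ∀ z, G.Adj v z → z ≠ x → z ≠ y → G.Adj x z := by
      intro x hx y hy hxy hnxy z hz hzx hzy
      by_contra hnxz
      have hsub : {x, y, z} ⊆ (G.neighborFinset v).filter fun y => ¬ G.Adj x y := by
        intro t ht
        simp only [Finset.mem_insert, Finset.mem_singleton] at ht
        simp only [Finset.mem_filter, mem_neighborFinset]
        rcases ht with rfl | rfl | rfl
        · exact ⟨hx, G.irrefl⟩
        · exact ⟨hy, hnxy⟩
        · exact ⟨hz, hnxz⟩
      have hc := Finset.card_le_card hsub
      rw [Finset.card_eq_three.2 ⟨x, y, z, hxy, hzx.symm, hzy.symm, rfl⟩] at hc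
      have := hmiss x hx
      omega
    have h5 : 5 ≤ G.degree v := by
      have hsub : {a, b} ⊆ (G.neighborFinset v).filter fun y => ¬ G.Adj a y := by
        intro t ht
        simp only [Finset.mem_insert, Finset.mem_singleton] at ht
        simp only [Finset.mem_filter, mem_neighborFinset]
        rcases ht with rfl | rfl
        · exact ⟨hva, G.irrefl⟩
        · exact ⟨hvb, hnab⟩
      have hc := Finset.card_le_card hsub
      rw [Finset.card_pair hab] at hc
      have := hmiss a hva
      omega
    have hrest : 3 ≤ ((G.neighborFinset v) \ {a, b}).card := by
      have := Finset.le_card_sdiff {a, b} (G.neighborFinset v)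
      rw [Finset.card_pair hab, card_neighborFinset_eq_degree] at this
      omega
    obtain ⟨s, hs, hcard⟩ := Finset.exists_subset_card_eq hrest
    obtain ⟨c, d, e, hcd, hce, hde, rfl⟩ := Finset.card_eq_three.1 hcard
    have hmem : ∀ x ∈ ({c, d, e} : Finset V), G.Adj v x ∧ x ≠ a ∧ x ≠ b := by
      intro x hx
      simpa using hs hx
    obtain ⟨hvc, hca, hcb⟩ := hmem c (by simp)
    obtain ⟨hvd, hda, hdb⟩ := hmem d (by simp)
    obtain ⟨hve, hea, heb⟩ := hmem e (by simp)
    have ha : ∀ x, G.Adj v x → x ≠ a → x ≠ b → G.Adj a x := hone a hva b hvb hab hnab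
    have hb : ∀ x, G.Adj v x → x ≠ a → x ≠ b → G.Adj b x := fun x hx h₁ h₂ =>
      hone b hvb a hva hab.symm (fun h => hnab h.symm) x hx h₂ h₁
    by_cases hadj : G.Adj d e
    · exact hasMinor_top_five_of_wheel hva hvb hvc hvd hve (ha c hvc hca hcb) (hb c hvc hca hcb)
        (ha d hvd hda hdb) (ha e hve hea heb) (hb d hvd hda hdb) (hb e hve hea heb) hadj
        hab hcd hce
    · have hdc := hone d hvd e hve hde hadj c hvc hcd hce
      exact hasMinor_top_five_of_wheel hva hvb hve hvd hvc (ha e hve hea heb) (hb e hve hea heb)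
        (ha d hvd hda hdb) (ha c hvc hca hcb) (hb d hvd hda hdb) (hb c hvc hca hcb) hdc
        hab hde.symm hce.symm

/-- A graph with at least `m` edges has a spanning subgraph with exactly `m` edges. -/
theorem SimpleGraph.exists_le_ncard_edgeSet_eq {V : Type*} (G : SimpleGraph V) {m : ℕ}
    (hm : m ≤ G.edgeSet.ncard) : ∃ H ≤ G, H.edgeSet.ncard = m := by
  obtain ⟨E, hE, rfl⟩ := Set.exists_subset_card_eq hm
  refine ⟨.fromEdgeSet E, ?_, ?_⟩
  · rw [← edgeSet_subset_edgeSet, edgeSet_fromEdgeSet]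
    exact Set.sdiff_subset.trans hE
  · rw [edgeSet_fromEdgeSet, sdiff_eq_left.2]
    exact Set.disjoint_left.2 fun e he => G.not_isDiag_of_mem_edgeSet (hE he)

/-- A graph on `n ≥ 1` vertices with at least `3 * n - 1` edges has a `K₅` minor. -/
theorem hasMinor_top_five_of_ncard_edgeSet {V : Type*} [Finite V] [Nonempty V]
    (G : SimpleGraph V) (hG : 3 * Nat.card V ≤ G.edgeSet.ncard + 1) :
    HasMinor G (⊤ : SimpleGraph (Fin 5)) := by
  classical
  obtain ⟨n, hn⟩ : ∃ n, Nat.card V = n + 1 := Nat.exists_eq_succ_of_ne_zero Nat.card_pos.ne'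
  induction n generalizing V with
  | zero =>
    have := (Nat.card_eq_one_iff_unique.1 hn).1
    have hbot : G = ⊥ := Subsingleton.elim _ _
    simp [hbot] at hG
  | succ n ih =>
    have := Fintype.ofFinite V
    obtain ⟨H, hHG, hHcard⟩ :=
      G.exists_le_ncard_edgeSet_eq (m := 3 * Nat.card V - 1) (by omega)
    refine HasMinor.trans (.of_injective_hom (.ofLE hHG) fun _ _ h => h) ?_
    have hcompl : ∀ v : V, Nat.card ({v}ᶜ : Set V) = n + 1 := by
      intro v
      rw [Nat.card_coe_set_eq, Set.ncard_compl, Set.ncard_singleton, hn, Nat.add_sub_cancel]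
    have hne : ∀ v : V, Nonempty ({v}ᶜ : Set V) := fun v =>
      (Nat.card_pos_iff.1 (by rw [hcompl]; omega)).1
    by_cases hdeg : ∀ v, 4 ≤ H.degree v
    · by_cases hcod : ∀ u v, H.Adj u v → 3 ≤ (H.neighborFinset u ∩ H.neighborFinset v).card
      · obtain ⟨v, -, hv⟩ : ∃ v ∈ Finset.univ, H.degree v < 6 := by
          apply Finset.exists_lt_of_sum_lt
          rw [sum_degrees_eq_twice_card_edges, card_edgeFinset_eq_ncard, hHcard,
            Finset.sum_const, Finset.card_univ, ← Nat.card_eq_fintype_card, smul_eq_mul]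
          omega
        exact hasMinor_top_five_of_degree_le (by convert hdeg v) (by convert Nat.le_of_lt_succ hv)
          fun x hx => by convert hcod v x hx
      · push Not at hcod
        obtain ⟨u, v, huv, hlt⟩ := hcod
        have := hne v
        have hle := H.ncard_edgeSet_le_contractInto huv
        exact (hasMinor_contractInto H huv).trans
          (ih _ (by rw [hcompl]; grind) (hcompl v))
    · push Not at hdeg
      obtain ⟨v, hv⟩ := hdeg
      have := hne v
      have hle := H.ncard_edgeSet_le_induce_compl_singleton v
      exact (hasMinor_induce H _).trans (ih _ (by rw [hcompl]; grind) (hcompl v))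

open Classical in
/-- If every edge can be charged to one of its ends with no vertex charged more than `k` times,
then the graph is `(k + 1, 1)`-choosable. -/
theorem choosable_of_injective_charge {V : Type*} [Fintype V] {G : SimpleGraph V} {k : ℕ}
    (f : G.edgeSet → V × Fin k) (hf : Function.Injective f)
    (hmem : ∀ e : G.edgeSet, (f e).1 ∈ (e : Sym2 V)) : Choosable G (k + 1) 1 := by
  intro L hL hsep
  let D : V → Finset ℕ := fun v =>
    (Finset.univ.filter fun e => (f e).1 = v).biUnion fun e =>
      (L v).filter fun c => ∀ x ∈ (e : Sym2 V), c ∈ L x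
  have hD : ∀ v, (D v).card ≤ k := by
    intro v
    have h₁ : (D v).card ≤ (Finset.univ.filter fun e => (f e).1 = v).card * 1 := by
      refine Finset.card_biUnion_le_card_mul _ _ _ fun e _ => ?_
      obtain ⟨⟨x, y⟩, he⟩ := e
      refine le_trans (Finset.card_le_card ?_) (hsep x y he)
      intro c hc
      have := (Finset.mem_filter.1 hc).2
      exact Finset.mem_inter.2 ⟨this x (Sym2.mem_mk_left x y), this y (Sym2.mem_mk_right x y)⟩
    have h₂ : (Finset.univ.filter fun e => (f e).1 = v).card ≤ (Finset.univ : Finset (Fin k)).card :=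
      Finset.card_le_card_of_injOn (fun e => (f e).2) (by simp) fun e he e' he' h =>
        hf (Prod.ext (by simp_all) h)
    simp at h₂
    omega
  have hex : ∀ v, ∃ c ∈ L v, c ∉ D v := fun v =>
    Finset.exists_mem_notMem_of_card_lt_card (lt_of_le_of_lt (hD v) (hL v))
  choose φ hφL hφD using hex
  refine ⟨φ, hφL, fun u v huv heq => ?_⟩
  let e : G.edgeSet := ⟨s(u, v), huv⟩
  have hmem' : (f e).1 = u ∨ (f e).1 = v := Sym2.mem_iff.1 (hmem e)
  have hcommon : ∀ x ∈ (e : Sym2 V), φ u ∈ L x := by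
    intro x hx
    rcases Sym2.mem_iff.1 hx with rfl | rfl
    · exact hφL _
    · exact heq ▸ hφL _
  have hcharge : φ u ∈ D (f e).1 := by
    simp only [D, Finset.mem_biUnion, Finset.mem_filter, Finset.mem_univ, true_and]
    exact ⟨e, rfl, hcommon _ (hmem e), hcommon⟩
  rcases hmem' with h | h
  · exact hφD u (h ▸ hcharge)
  · exact hφD v (heq ▸ h ▸ hcharge)

open Classical in
/-- Hakimi's criterion: if each induced subgraph has at most `k` times as many edges as vertices,
then the edges can be charged to their ends with no vertex charged more than `k` times. -/
theorem exists_injective_charge {V : Type*} [Fintype V] {G : SimpleGraph V} {k : ℕ}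
    (h : ∀ s : Finset V, (G.induce (s : Set V)).edgeSet.ncard ≤ k * s.card) :
    ∃ f : G.edgeSet → V × Fin k, Function.Injective f ∧
      ∀ e : G.edgeSet, (f e).1 ∈ (e : Sym2 V) := by
  let t : G.edgeSet → Finset (V × Fin k) := fun e =>
    (Finset.univ.filter (· ∈ (e : Sym2 V))) ×ˢ Finset.univ
  obtain ⟨f, hf, hft⟩ := (Finset.all_card_le_biUnion_card_iff_exists_injective t).1 fun s => by
    let W : Finset V := Finset.univ.filter fun v => ∃ e ∈ s, v ∈ (e : Sym2 V)
    have ht : s.biUnion t = W ×ˢ Finset.univ := by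
      ext ⟨v, i⟩
      simp [t, W]
    rw [ht, Finset.card_product, Finset.card_univ, Fintype.card_fin, mul_comm]
    refine le_trans ?_ (h W)
    rw [← Finset.card_map (.subtype _), ← card_edgeFinset_eq_ncard]
    refine le_trans (Finset.card_le_card (t := (G.induce (W : Set V)).edgeFinset.image
      (Sym2.map Subtype.val)) ?_) Finset.card_image_le
    intro e he
    obtain ⟨⟨⟨x, y⟩, hxy⟩, hs, rfl⟩ := Finset.mem_map.1 he
    have hx : x ∈ (W : Set V) := by
      simpa [W] using ⟨_, ⟨hxy, hs⟩, Sym2.mem_mk_left x y⟩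
    have hy : y ∈ (W : Set V) := by
      simpa [W] using ⟨_, ⟨hxy, hs⟩, Sym2.mem_mk_right x y⟩
    refine Finset.mem_image.2 ⟨s(⟨x, hx⟩, ⟨y, hy⟩), ?_, rfl⟩
    rw [mem_edgeFinset]
    exact hxy
  exact ⟨f, hf, fun e => by simpa [t] using hft e⟩

theorem stmt_8 {V : Type*} [Fintype V] (G : SimpleGraph V) (hG : IsPlanar G) :
    Choosable G 4 1 := by
  classical
  obtain ⟨f, hf, hmem⟩ := exists_injective_charge (G := G) (k := 3) fun s => by
    by_contra! hlt
    rcases s.eq_empty_or_nonempty with rfl | ⟨v, hv⟩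
    · simp [Set.eq_empty_of_isEmpty] at hlt
    · have : Nonempty (s : Set V) := ⟨⟨v, hv⟩⟩
      refine hG.1 ((hasMinor_induce G s).trans (hasMinor_top_five_of_ncard_edgeSet _ ?_))
      rw [Nat.card_coe_set_eq, Set.ncard_coe_finset]
      omega
  exact choosable_of_injective_charge f hf hmem
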